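/- arXiv:2203.02551 — 5 statements merged into one kernel-verified Lean document; each statement's English description precedes it below -/
import Mathlib

section
/- (Helly selection) Every sequence $(\mu_n)_n$ of probability measures on $(\mathbb{R},\mathcal{B})$ has a subsequence that converges vaguely to some sub-probability measure $\mu$ on $(\mathbb{R},\mathcal{B})$; that is, there exist an infinite set $I\subseteq\mathbb{N}$ and a Borel measure $\mu$ with $\mu(\mathbb{R})\le 1$ such that $\int f\,d\mu_n \to \int f\,d\mu$ along $n\in I$ for every continuous $f:\mathbb{R}\to\mathbb{R}$ with compact support. Moreover, if $(\mu_n)_n$ is tight, the subsequence can be chosen so that $\mu$ is a probability measure and the convergence holds for all bounded continuous $f$. -/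
open MeasureTheory Filter Topology
open scoped ENNReal

/-- Extending a compactly supported continuous function by zero along an open embedding into a
Hausdorff space gives a continuous function. -/
theorem Topology.IsOpenEmbedding.continuous_extend_zero {X Y : Type*} [TopologicalSpace X]
    [TopologicalSpace Y] [T2Space Y] {e : X → Y} (he : IsOpenEmbedding e) {f : X → ℝ}
    (hf : Continuous f) (hs : HasCompactSupport f) : Continuous (Function.extend e f 0) :=
  continuous_of_tsupport fun y hy => by
    obtain ⟨x, -, rfl⟩ := hs.tsupport_extend_zero_subset he.continuous hy
    rw [← he.continuousAt_iff, Function.extend_comp he.injective]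
    exact hf.continuousAt

/-- Integrating a function extended by zero along a measurable embedding amounts to integrating
against the pulled back measure. -/
theorem MeasurableEmbedding.integral_extend_zero {X Y : Type*} [MeasurableSpace X]
    [MeasurableSpace Y] {e : X → Y} (he : MeasurableEmbedding e) (f : X → ℝ) (μ : Measure Y) :
    ∫ y, Function.extend e f 0 y ∂μ = ∫ x, f x ∂(μ.comap e) := by
  have h_zero : ∀ y ∉ Set.range e, Function.extend e f 0 y = 0 := fun y hy =>
    Function.extend_apply' _ _ _ hy
  rw [← setIntegral_eq_integral_of_forall_compl_eq_zero h_zero, ← he.map_comap,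
    he.integral_map]
  simp only [he.injective.extend_apply]

/-- Every sequence of probability measures on `ℝ` has a vaguely convergent subsequence. -/
theorem exists_subseq_tendsto_vaguely (μ : ℕ → Measure ℝ) [∀ n, IsProbabilityMeasure (μ n)] :
    ∃ φ : ℕ → ℕ, StrictMono φ ∧ ∃ ν : Measure ℝ, ν Set.univ ≤ 1 ∧
      ∀ f : ℝ → ℝ, Continuous f → HasCompactSupport f →
        Tendsto (fun k => ∫ x, f x ∂(μ (φ k))) atTop (𝓝 (∫ x, f x ∂ν)) := by
  have he := EReal.measurableEmbedding_coe
  let P : ℕ → ProbabilityMeasure EReal := fun n =>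
    ⟨(μ n).map Real.toEReal, Measure.isProbabilityMeasure_map he.measurable.aemeasurable⟩
  have hP n : (P n : Measure EReal).comap Real.toEReal = μ n := he.comap_map _
  obtain ⟨ν, φ, hφ, hν⟩ := CompactSpace.tendsto_subseq P
  refine ⟨φ, hφ, (ν : Measure EReal).comap Real.toEReal, ?_, fun f hf hs => ?_⟩
  · rw [he.comap_apply]
    exact prob_le_one
  · have h := ProbabilityMeasure.tendsto_iff_forall_integral_tendsto.1 hν
      (BoundedContinuousFunction.mkOfCompact
        ⟨_, EReal.isOpenEmbedding_coe.continuous_extend_zero hf hs⟩)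
    simpa [he.integral_extend_zero, hP] using h

/-- Every tight sequence of probability measures on `ℝ` has a weakly convergent subsequence. -/
theorem exists_subseq_tendsto_weakly_of_tight (μ : ℕ → Measure ℝ)
    [∀ n, IsProbabilityMeasure (μ n)]
    (h_tight : ∀ ε : ℝ, 0 < ε → ∃ K : Set ℝ, IsCompact K ∧ ∀ n, μ n Kᶜ ≤ ENNReal.ofReal ε) :
    ∃ φ : ℕ → ℕ, StrictMono φ ∧ ∃ ν : Measure ℝ, IsProbabilityMeasure ν ∧
      ∀ f : ℝ → ℝ, Continuous f → (∃ C, ∀ x, |f x| ≤ C) →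
        Tendsto (fun k => ∫ x, f x ∂(μ (φ k))) atTop (𝓝 (∫ x, f x ∂ν)) := by
  let P : ℕ → ProbabilityMeasure ℝ := fun n => ⟨μ n, inferInstance⟩
  have h_set : IsTightMeasureSet {((ρ : ProbabilityMeasure ℝ) : Measure ℝ) | ρ ∈ Set.range P} := by
    rw [isTightMeasureSet_iff_exists_isCompact_measure_compl_le]
    intro ε hε
    obtain ⟨δ, -, hδ_pos, hδε⟩ := ENNReal.lt_iff_exists_real_btwn.1 hε
    obtain ⟨K, hK, hμK⟩ := h_tight δ (ENNReal.ofReal_pos.1 hδ_pos)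
    refine ⟨K, hK, ?_⟩
    rintro _ ⟨_, ⟨n, rfl⟩, rfl⟩
    exact (hμK n).trans hδε.le
  obtain ⟨ν, -, φ, hφ, hν⟩ := (isCompact_closure_of_isTightMeasureSet h_set).tendsto_subseq
    fun n => subset_closure (Set.mem_range_self n)
  refine ⟨φ, hφ, ν, inferInstance, fun f hf ⟨C, hC⟩ => ?_⟩
  exact ProbabilityMeasure.tendsto_iff_forall_integral_tendsto.1 hν
    (BoundedContinuousFunction.ofNormedAddCommGroup f hf C hC)

/-- **Helly's selection theorem.** Every sequence of probability measures on `ℝ` has a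
subsequence converging vaguely to a sub-probability measure; if the sequence is tight,
the subsequence can be chosen to converge weakly to a probability measure. -/
theorem helly_selection
    (μ : ℕ → Measure ℝ) [∀ n, IsProbabilityMeasure (μ n)] :
    (∃ φ : ℕ → ℕ, StrictMono φ ∧ ∃ ν : Measure ℝ, ν Set.univ ≤ 1 ∧
      ∀ f : ℝ → ℝ, Continuous f → HasCompactSupport f →
        Tendsto (fun k => ∫ x, f x ∂(μ (φ k))) atTop (𝓝 (∫ x, f x ∂ν))) ∧
    ((∀ ε : ℝ, 0 < ε → ∃ K : Set ℝ, IsCompact K ∧ ∀ n, μ n Kᶜ ≤ ENNReal.ofReal ε) →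
      ∃ φ : ℕ → ℕ, StrictMono φ ∧ ∃ ν : Measure ℝ, IsProbabilityMeasure ν ∧
        ∀ f : ℝ → ℝ, Continuous f → (∃ C, ∀ x, |f x| ≤ C) →
          Tendsto (fun k => ∫ x, f x ∂(μ (φ k))) atTop (𝓝 (∫ x, f x ∂ν))) :=
  ⟨exists_subseq_tendsto_vaguely μ, exists_subseq_tendsto_weakly_of_tight μ⟩
end

section
/- (Method of moments) Let $(\mu_n)_n$ be probability measures on $(\mathbb{R},\mathcal{B})$ such that every $\mu_n$ has finite moments of all orders, and suppose there are real numbers $(m_k)_{k\in\mathbb{N}}$ with $\int x^k\,d\mu_n \to m_k$ as $n\to\infty$ for every $k\in\mathbb{N}$. Then: (1) there exist a probability measure $\mu$ on $(\mathbb{R},\mathcal{B})$ and a subsequence of $(\mu_n)$ converging weakly to $\mu$, and $\int x^k\,d\mu = m_k$ for all $k$; (2) if moreover $\mu$ is uniquely determined by its moments (i.e. any probability measure with the same moments equals $\mu$), then the entire sequence $(\mu_n)_n$ converges weakly to $\mu$. -/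
open MeasureTheory Filter Topology

/-- The weak-convergence statement for bounded continuous functions, unbundled. -/
lemma tendsto_integral_of_tendsto_probabilityMeasure {Ω : Type*} [MeasurableSpace Ω]
    [TopologicalSpace Ω] [OpensMeasurableSpace Ω] {ι : Type*} {l : Filter ι}
    {P : ι → ProbabilityMeasure Ω} {Q : ProbabilityMeasure Ω} (h : Tendsto P l (𝓝 Q))
    {f : Ω → ℝ} (hf : Continuous f) {C : ℝ} (hC : ∀ x, |f x| ≤ C) :
    Tendsto (fun i => ∫ x, f x ∂(P i : Measure Ω)) l (𝓝 (∫ x, f x ∂(Q : Measure Ω))) :=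
  ProbabilityMeasure.tendsto_iff_forall_integral_tendsto.1 h
    (BoundedContinuousFunction.ofNormedAddCommGroup f hf C hC)

/-- Truncating at level `M` costs at most a second moment over `M`. -/
lemma abs_sub_truncation_le {M : ℝ} (hM : 0 < M) (y : ℝ) :
    |y - max (-M) (min y M)| ≤ y ^ 2 / M := by
  rw [le_div_iff₀ hM]
  rcases le_total y M with h1 | h1
  · rw [min_eq_left h1]
    rcases le_total (-M) y with h2 | h2
    · rw [max_eq_right h2, sub_self, abs_zero, zero_mul]
      positivity
    · rw [max_eq_left h2, abs_of_nonpos (by linarith)]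
      nlinarith
  · rw [min_eq_right h1, max_eq_right (by linarith), abs_of_nonneg (by linarith)]
    nlinarith

lemma abs_truncation_le {M : ℝ} (hM : 0 ≤ M) (y : ℝ) : |max (-M) (min y M)| ≤ M :=
  abs_le.2 ⟨le_max_left _ _, max_le (by linarith) (min_le_right _ _)⟩

lemma abs_integral_sub_integral_truncation_le {Ω : Type*} [MeasurableSpace Ω]
    [TopologicalSpace Ω] [OpensMeasurableSpace Ω] {ρ : Measure Ω} [IsProbabilityMeasure ρ]
    {f : Ω → ℝ} {C : ℝ}
    (hf : Continuous f) (hint : Integrable f ρ) (hint2 : Integrable (fun x => f x ^ 2) ρ)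
    (hC : ∫ x, f x ^ 2 ∂ρ ≤ C) {M : ℝ} (hM : 0 < M) :
    |∫ x, f x ∂ρ - ∫ x, max (-M) (min (f x) M) ∂ρ| ≤ C / M := by
  have htr : Integrable (fun x => max (-M) (min (f x) M)) ρ :=
    Integrable.of_bound
      (by fun_prop : Continuous fun x => max (-M) (min (f x) M)).measurable.aestronglyMeasurable
      M (Eventually.of_forall fun x => abs_truncation_le hM.le (f x))
  rw [← integral_sub hint htr]
  calc |∫ x, (f x - max (-M) (min (f x) M)) ∂ρ|
      ≤ ∫ x, |f x - max (-M) (min (f x) M)| ∂ρ := abs_integral_le_integral_abs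
    _ ≤ ∫ x, f x ^ 2 / M ∂ρ :=
        integral_mono (hint.sub htr).abs (hint2.div_const M)
          fun x => abs_sub_truncation_le hM (f x)
    _ = (∫ x, f x ^ 2 ∂ρ) / M := integral_div _ _
    _ ≤ C / M := by gcongr

section Limit

variable {Ω : Type*} [MeasurableSpace Ω] [TopologicalSpace Ω] [OpensMeasurableSpace Ω]
  [HasOuterApproxClosed Ω] {P : ℕ → ProbabilityMeasure Ω} {Q : ProbabilityMeasure Ω}
  {f : Ω → ℝ} {C : ℝ}

/-- Fatou's lemma along a weakly convergent sequence, for integrals bounded by a constant. -/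
lemma lintegral_ofReal_le_of_tendsto_of_integral_le (h : Tendsto P atTop (𝓝 Q))
    (hf : Continuous f) (hf0 : 0 ≤ f) (hint : ∀ n, Integrable f (P n : Measure Ω))
    (hC : ∀ n, ∫ x, f x ∂(P n : Measure Ω) ≤ C) :
    ∫⁻ x, ENNReal.ofReal (f x) ∂(Q : Measure Ω) ≤ ENNReal.ofReal C := by
  refine (lintegral_le_liminf_lintegral_of_forall_isOpen_measure_le_liminf_measure
    (μs := fun n => (P n : Measure Ω)) hf hf0
    fun G hG => ProbabilityMeasure.le_liminf_measure_open_of_tendsto h hG).trans ?_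
  refine (liminf_le_liminf (v := fun _ : ℕ => ENNReal.ofReal C)
    (Eventually.of_forall fun n => ?_)).trans_eq (liminf_const _)
  rw [← ofReal_integral_eq_lintegral_ofReal (hint n) (Eventually.of_forall hf0)]
  exact ENNReal.ofReal_le_ofReal (hC n)

lemma integrable_of_tendsto_of_integral_le (h : Tendsto P atTop (𝓝 Q))
    (hf : Continuous f) (hf0 : 0 ≤ f) (hint : ∀ n, Integrable f (P n : Measure Ω))
    (hC : ∀ n, ∫ x, f x ∂(P n : Measure Ω) ≤ C) :
    Integrable f (Q : Measure Ω) := by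
  refine ⟨hf.measurable.aestronglyMeasurable, ?_⟩
  rw [hasFiniteIntegral_iff_ofReal (Eventually.of_forall hf0)]
  exact (lintegral_ofReal_le_of_tendsto_of_integral_le h hf hf0 hint hC).trans_lt
    ENNReal.ofReal_lt_top

lemma integral_le_of_tendsto_of_integral_le (h : Tendsto P atTop (𝓝 Q))
    (hf : Continuous f) (hf0 : 0 ≤ f) (hint : ∀ n, Integrable f (P n : Measure Ω))
    (hC : ∀ n, ∫ x, f x ∂(P n : Measure Ω) ≤ C) :
    ∫ x, f x ∂(Q : Measure Ω) ≤ C := by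
  have hC0 : 0 ≤ C := (integral_nonneg hf0).trans (hC 0)
  rw [integral_eq_lintegral_of_nonneg_ae (Eventually.of_forall hf0)
    hf.measurable.aestronglyMeasurable]
  exact ENNReal.toReal_le_of_le_ofReal hC0
    (lintegral_ofReal_le_of_tendsto_of_integral_le h hf hf0 hint hC)

/-- Along a weakly convergent sequence of probability measures, integrals of a continuous function
with bounded second moments converge. -/
lemma tendsto_integral_of_tendsto_of_integral_sq_le (h : Tendsto P atTop (𝓝 Q))
    (hf : Continuous f) (hint : ∀ n, Integrable f (P n : Measure Ω))
    (hintQ : Integrable f (Q : Measure Ω))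
    (hint2 : ∀ n, Integrable (fun x => f x ^ 2) (P n : Measure Ω))
    (hint2Q : Integrable (fun x => f x ^ 2) (Q : Measure Ω))
    (hC : ∀ n, ∫ x, f x ^ 2 ∂(P n : Measure Ω) ≤ C) :
    Tendsto (fun n => ∫ x, f x ∂(P n : Measure Ω)) atTop (𝓝 (∫ x, f x ∂(Q : Measure Ω))) := by
  have hC0 : 0 ≤ C := (integral_nonneg fun x => sq_nonneg (f x)).trans (hC 0)
  have hCQ := integral_le_of_tendsto_of_integral_le h (hf.pow 2) (fun x => sq_nonneg (f x)) hint2 hC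
  rw [Metric.tendsto_atTop]
  intro ε hε
  obtain ⟨M, hM, hCM⟩ : ∃ M : ℝ, 0 < M ∧ C / M < ε / 3 := by
    refine ⟨3 * (C + 1) / ε, by positivity, ?_⟩
    rw [div_lt_iff₀ (by positivity)]
    field_simp
    linarith
  obtain ⟨N, hN⟩ := Metric.tendsto_atTop.1
    (tendsto_integral_of_tendsto_probabilityMeasure h
      (by fun_prop : Continuous fun x => max (-M) (min (f x) M))
      fun x => abs_truncation_le hM.le (f x)) (ε / 3) (by positivity)
  refine ⟨N, fun n hn => ?_⟩
  have h1 := abs_le.1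
    (abs_integral_sub_integral_truncation_le hf (hint n) (hint2 n) (hC n) hM)
  have h2 := abs_lt.1 (hN n hn)
  have h3 := abs_le.1 (abs_integral_sub_integral_truncation_le hf hintQ hint2Q hCQ hM)
  rw [Real.dist_eq, abs_lt]
  constructor <;> linarith [h1.1, h1.2, h2.1, h2.2, h3.1, h3.2]

end Limit

/-- Finite measures on `ℝ` with uniformly bounded second moments form a tight family. -/
lemma isTightMeasureSet_of_integral_sq_le {S : Set (Measure ℝ)} {C : ℝ}
    (hS : ∀ ρ ∈ S, IsFiniteMeasure ρ)
    (hint : ∀ ρ ∈ S, Integrable (fun x : ℝ => x ^ 2) ρ) (hC : ∀ ρ ∈ S, ∫ x, x ^ 2 ∂ρ ≤ C) :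
    IsTightMeasureSet S := by
  refine isTightMeasureSet_of_tendsto_measure_norm_gt ?_
  have hlim : Tendsto (fun r : ℝ => ENNReal.ofReal (C / r ^ 2)) atTop (𝓝 0) := by
    rw [← ENNReal.ofReal_zero]
    exact ENNReal.tendsto_ofReal
      (tendsto_const_nhds.div_atTop (tendsto_pow_atTop two_ne_zero))
  refine tendsto_of_tendsto_of_tendsto_of_le_of_le' tendsto_const_nhds hlim
    (Eventually.of_forall fun _ => zero_le) ?_
  filter_upwards [eventually_gt_atTop 0] with r hr
  refine iSup₂_le fun ρ hR => ?_
  have := hS ρ hR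
  have hsub : {x : ℝ | r < ‖x‖} ⊆ {x : ℝ | r ^ 2 ≤ x ^ 2} := fun x hx => by
    have hx' : r < |x| := hx
    change r ^ 2 ≤ x ^ 2
    rw [← sq_abs x]
    gcongr
  refine (measure_mono hsub).trans ?_
  rw [← ofReal_measureReal]
  refine ENNReal.ofReal_le_ofReal ?_
  rw [le_div_iff₀ (by positivity), mul_comm]
  exact (mul_meas_ge_le_integral_of_nonneg (Eventually.of_forall fun x : ℝ => sq_nonneg x)
    (hint ρ hR) (r ^ 2)).trans (hC ρ hR)

/-- If the moments converge, some subsequence converges weakly to a probability measure having the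
limits as its moments. -/
lemma exists_subseq_tendsto_of_tendsto_moments (P : ℕ → ProbabilityMeasure ℝ)
    (hint : ∀ n k : ℕ, Integrable (fun x : ℝ => x ^ k) (P n : Measure ℝ)) (m : ℕ → ℝ)
    (hm : ∀ k : ℕ, 0 < k →
      Tendsto (fun n => ∫ x, x ^ k ∂(P n : Measure ℝ)) atTop (𝓝 (m k))) :
    ∃ (Q : ProbabilityMeasure ℝ) (φ : ℕ → ℕ), StrictMono φ ∧ Tendsto (P ∘ φ) atTop (𝓝 Q) ∧
      ∀ k : ℕ, 0 < k →
        Integrable (fun x : ℝ => x ^ k) (Q : Measure ℝ) ∧ ∫ x, x ^ k ∂(Q : Measure ℝ) = m k := by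
  have hbdd (k : ℕ) (hk : 0 < k) : ∃ C, ∀ n, ∫ x, x ^ k ∂(P n : Measure ℝ) ≤ C := by
    obtain ⟨C, hC⟩ := (hm k hk).bddAbove_range
    exact ⟨C, fun n => hC ⟨n, rfl⟩⟩
  obtain ⟨C, hC⟩ := hbdd 2 two_pos
  have hcomp : IsCompact (closure (Set.range P)) := by
    refine isCompact_closure_of_isTightMeasureSet
      (isTightMeasureSet_of_integral_sq_le (C := C) ?_ ?_ ?_)
    · rintro _ ⟨_, -, rfl⟩
      infer_instance
    · rintro _ ⟨_, ⟨n, rfl⟩, rfl⟩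
      exact hint n 2
    · rintro _ ⟨_, ⟨n, rfl⟩, rfl⟩
      exact hC n
  obtain ⟨Q, -, φ, hφ, hQ⟩ :=
    hcomp.tendsto_subseq fun n => subset_closure (Set.mem_range_self (f := P) n)
  have heven (k : ℕ) (hk : 0 < k) : Integrable (fun x : ℝ => (x ^ k) ^ 2) (Q : Measure ℝ) := by
    obtain ⟨B, hB⟩ := hbdd (k * 2) (by positivity)
    simp_rw [pow_mul] at hB
    exact integrable_of_tendsto_of_integral_le hQ (by fun_prop) (fun x => sq_nonneg _)
      (fun n => by simpa only [pow_mul, Function.comp_apply] using hint (φ n) (k * 2)) fun n => hB (φ n)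
  refine ⟨Q, φ, hφ, hQ, fun k hk => ?_⟩
  have hintQ : Integrable (fun x : ℝ => x ^ k) (Q : Measure ℝ) :=
    ((memLp_two_iff_integrable_sq (by fun_prop)).2 (heven k hk)).integrable (by norm_num)
  obtain ⟨B, hB⟩ := hbdd (k * 2) (by positivity)
  simp_rw [pow_mul] at hB
  exact ⟨hintQ, tendsto_nhds_unique
    (tendsto_integral_of_tendsto_of_integral_sq_le hQ (by fun_prop) (fun n => hint (φ n) k) hintQ
      (fun n => by simpa only [pow_mul, Function.comp_apply] using hint (φ n) (k * 2)) (heven k hk)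
      fun n => hB (φ n))
    ((hm k hk).comp hφ.tendsto_atTop)⟩

/-- **The method of moments.** If the moments of probability measures `μ n` converge to
numbers `m k`, then some subsequence of `(μ n)` converges weakly to a probability
measure `ν` whose moments are the `m k`; and if `ν` is uniquely determined by its
moments, the whole sequence converges weakly to `ν`. -/
theorem method_of_moments
    (μ : ℕ → Measure ℝ) [∀ n, IsProbabilityMeasure (μ n)]
    (hint : ∀ (n : ℕ) (k : ℕ), Integrable (fun x : ℝ => x ^ k) (μ n))
    (m : ℕ → ℝ)
    (hm : ∀ k : ℕ, 0 < k → Tendsto (fun n => ∫ x, x ^ k ∂(μ n)) atTop (𝓝 (m k))) :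
    ∃ ν : Measure ℝ, IsProbabilityMeasure ν ∧
      (∀ k : ℕ, 0 < k → Integrable (fun x : ℝ => x ^ k) ν ∧ ∫ x, x ^ k ∂ν = m k) ∧
      (∃ φ : ℕ → ℕ, StrictMono φ ∧
        ∀ f : ℝ → ℝ, Continuous f → (∃ C, ∀ x, |f x| ≤ C) →
          Tendsto (fun j => ∫ x, f x ∂(μ (φ j))) atTop (𝓝 (∫ x, f x ∂ν))) ∧
      ((∀ ρ : Measure ℝ, IsProbabilityMeasure ρ →
          (∀ k : ℕ, 0 < k → Integrable (fun x : ℝ => x ^ k) ρ) →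
          (∀ k : ℕ, 0 < k → ∫ x, x ^ k ∂ρ = ∫ x, x ^ k ∂ν) → ρ = ν) →
        ∀ f : ℝ → ℝ, Continuous f → (∃ C, ∀ x, |f x| ≤ C) →
          Tendsto (fun n => ∫ x, f x ∂(μ n)) atTop (𝓝 (∫ x, f x ∂ν))) := by
  let P : ℕ → ProbabilityMeasure ℝ := fun n => ⟨μ n, inferInstance⟩
  obtain ⟨Q, φ, hφ, hQ, hmom⟩ := exists_subseq_tendsto_of_tendsto_moments P hint m hm
  refine ⟨Q, inferInstance, hmom, ⟨φ, hφ, fun f hf ⟨C, hC⟩ =>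
    tendsto_integral_of_tendsto_probabilityMeasure hQ hf hC⟩, fun huniq f hf ⟨C, hC⟩ => ?_⟩
  suffices hP : Tendsto P atTop (𝓝 Q) from
    tendsto_integral_of_tendsto_probabilityMeasure hP hf hC
  refine tendsto_of_subseq_tendsto fun ns hns => ?_
  obtain ⟨Q', ms, -, hQ', hmom'⟩ := exists_subseq_tendsto_of_tendsto_moments (P ∘ ns)
    (fun n => hint (ns n)) m fun k hk => (hm k hk).comp hns
  have hQQ : Q' = Q := Subtype.ext <| huniq Q' inferInstance (fun k hk => (hmom' k hk).1)
    fun k hk => (hmom' k hk).2.trans (hmom k hk).2.symm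
  exact ⟨ms, hQQ ▸ hQ'⟩
end

section
/- The semicircle distribution $\sigma$ is a probability measure, and its moments are given by: for every $k\in\mathbb{N}_0$, $\int x^{2k}\,d\sigma = \frac{(2k)!}{k!\,(k+1)!}$ (the $k$-th Catalan number) and $\int x^{2k+1}\,d\sigma = 0$. -/
open MeasureTheory Filter Topology

/-- The semicircle distribution on `ℝ`. -/
noncomputable def semicircleMeasure : Measure ℝ :=
  volume.withDensity fun x =>
    Set.indicator (Set.Icc (-2 : ℝ) 2)
      (fun x => ENNReal.ofReal (Real.sqrt (4 - x ^ 2) / (2 * Real.pi))) x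

/-- Moments of the semicircle distribution as interval integrals. -/
lemma integral_pow_semicircleMeasure (n : ℕ) :
    ∫ x, x ^ n ∂semicircleMeasure =
      (∫ x in (-2 : ℝ)..2, x ^ n * Real.sqrt (4 - x ^ 2)) / (2 * Real.pi) := by
  have hm : Measurable fun x : ℝ => Set.indicator (Set.Icc (-2 : ℝ) 2)
      (fun x => ENNReal.ofReal (Real.sqrt (4 - x ^ 2) / (2 * Real.pi))) x :=
    Measurable.indicator (by fun_prop) measurableSet_Icc
  have hlt : ∀ᵐ x : ℝ, Set.indicator (Set.Icc (-2 : ℝ) 2)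
      (fun x => ENNReal.ofReal (Real.sqrt (4 - x ^ 2) / (2 * Real.pi))) x < ⊤ := by
    refine Eventually.of_forall fun x => ?_
    by_cases hx : x ∈ Set.Icc (-2 : ℝ) 2 <;> simp [hx]
  rw [semicircleMeasure, integral_withDensity_eq_integral_toReal_smul hm hlt,
    intervalIntegral.integral_of_le (by norm_num), ← integral_Icc_eq_integral_Ioc,
    ← integral_div, ← integral_indicator measurableSet_Icc]
  refine integral_congr_ae (Eventually.of_forall fun x => ?_)
  by_cases hx : x ∈ Set.Icc (-2 : ℝ) 2
  · have h : 0 ≤ Real.sqrt (4 - x ^ 2) / (2 * Real.pi) := by positivity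
    simp only [Set.indicator_of_mem hx, ENNReal.toReal_ofReal h, smul_eq_mul]
    ring
  · simp [Set.indicator_of_notMem hx]

/-- The recursion for the integrals of powers of the sine over `[-π/2, π/2]`. -/
lemma integral_sin_pow_neg_pi_div_two (n : ℕ) :
    ∫ t in (-(Real.pi / 2))..(Real.pi / 2), Real.sin t ^ (n + 2) =
      (n + 1) / (n + 2) * ∫ t in (-(Real.pi / 2))..(Real.pi / 2), Real.sin t ^ n := by
  simp [integral_sin_pow]

/-- The substitution `x = 2 sin t`. -/
lemma integral_pow_mul_sqrt_four_sub_sq (n : ℕ) :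
    ∫ x in (-2 : ℝ)..2, x ^ n * Real.sqrt (4 - x ^ 2) =
      2 ^ (n + 2) / (n + 2) *
        ∫ t in (-(Real.pi / 2))..(Real.pi / 2), Real.sin t ^ n := by
  have hsub := intervalIntegral.integral_comp_mul_deriv
    (a := -(Real.pi / 2)) (b := Real.pi / 2) (f := fun t => 2 * Real.sin t)
    (f' := fun t => 2 * Real.cos t) (g := fun x => x ^ n * Real.sqrt (4 - x ^ 2))
    (fun t _ => (Real.hasDerivAt_sin t).const_mul 2) (by fun_prop) (by fun_prop)
  simp only [Real.sin_neg, Real.sin_pi_div_two, mul_neg, mul_one] at hsub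
  rw [← hsub]
  have hcongr : ∀ t ∈ Set.uIcc (-(Real.pi / 2)) (Real.pi / 2),
      ((fun x : ℝ => x ^ n * Real.sqrt (4 - x ^ 2)) ∘ fun t => 2 * Real.sin t) t *
        (2 * Real.cos t) = 2 ^ (n + 2) * (Real.sin t ^ n - Real.sin t ^ (n + 2)) := by
    intro t ht
    rw [Set.uIcc_of_le (by linarith [Real.pi_pos])] at ht
    have hcos : 0 ≤ Real.cos t := Real.cos_nonneg_of_mem_Icc ht
    have hsqrt : Real.sqrt (4 - (2 * Real.sin t) ^ 2) = 2 * Real.cos t := by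
      rw [← Real.sqrt_sq (by positivity : 0 ≤ 2 * Real.cos t)]
      congr 1
      linear_combination -4 * Real.sin_sq_add_cos_sq t
    simp only [Function.comp_apply, hsqrt]
    linear_combination 2 ^ (n + 2) * Real.sin t ^ n * Real.sin_sq_add_cos_sq t
  rw [intervalIntegral.integral_congr hcongr, intervalIntegral.integral_const_mul,
    intervalIntegral.integral_sub (Continuous.intervalIntegrable (by fun_prop) _ _)
      (Continuous.intervalIntegrable (by fun_prop) _ _), integral_sin_pow_neg_pi_div_two]
  field_simp
  ring

/-- The two-step recursion for the moments of the semicircle distribution. -/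
lemma integral_pow_add_two_semicircleMeasure (n : ℕ) :
    ∫ x, x ^ (n + 2) ∂semicircleMeasure =
      4 * (n + 1) / (n + 4) * ∫ x, x ^ n ∂semicircleMeasure := by
  simp only [integral_pow_semicircleMeasure, integral_pow_mul_sqrt_four_sub_sq,
    integral_sin_pow_neg_pi_div_two]
  push_cast
  field_simp
  ring

lemma integral_pow_even_semicircleMeasure (k : ℕ) :
    ∫ x, x ^ (2 * k) ∂semicircleMeasure =
      (Nat.factorial (2 * k) : ℝ) / ((Nat.factorial k : ℝ) * (Nat.factorial (k + 1) : ℝ)) := by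
  induction k with
  | zero =>
    rw [integral_pow_semicircleMeasure, integral_pow_mul_sqrt_four_sub_sq]
    simp
    field_simp
  | succ k ih =>
    rw [mul_add, mul_one, integral_pow_add_two_semicircleMeasure, ih]
    simp only [Nat.factorial_succ]
    push_cast
    field_simp
    ring

lemma integral_pow_odd_semicircleMeasure (k : ℕ) :
    ∫ x, x ^ (2 * k + 1) ∂semicircleMeasure = 0 := by
  induction k with
  | zero =>
    rw [integral_pow_semicircleMeasure, integral_pow_mul_sqrt_four_sub_sq]
    simp
  | succ k ih =>
    rw [show 2 * (k + 1) + 1 = 2 * k + 1 + 2 by ring,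
      integral_pow_add_two_semicircleMeasure, ih, mul_zero]

/-- The semicircle distribution is a probability measure whose even moments are the
Catalan numbers and whose odd moments vanish. -/
theorem semicircle_moments :
    IsProbabilityMeasure semicircleMeasure ∧
    (∀ k : ℕ, ∫ x, x ^ (2 * k) ∂semicircleMeasure =
      (Nat.factorial (2 * k) : ℝ) / ((Nat.factorial k : ℝ) * (Nat.factorial (k + 1) : ℝ))) ∧
    (∀ k : ℕ, ∫ x, x ^ (2 * k + 1) ∂semicircleMeasure = 0) := by
  refine ⟨⟨?_⟩, integral_pow_even_semicircleMeasure, integral_pow_odd_semicircleMeasure⟩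
  have h := integral_pow_even_semicircleMeasure 0
  simp only [mul_zero, pow_zero, integral_const, smul_eq_mul, mul_one, Measure.real] at h
  rw [← ENNReal.toReal_eq_one_iff, h]
  simp
end

section
/- (Stieltjes inversion) Let $\mu$ be a finite measure on $(\mathbb{R},\mathcal{B})$ and let $\alpha < \beta$ be real numbers. Then $\lim_{\eta\searrow 0} \frac{1}{\pi}\int_{\alpha}^{\beta} \operatorname{Im} S_\mu(E + i\eta)\,dE = \mu((\alpha,\beta)) + \frac{1}{2}\big(\mu(\{\alpha\}) + \mu(\{\beta\})\big)$. Consequently, the map $\mu \mapsto S_\mu$ is injective on finite measures: if two finite measures on $(\mathbb{R},\mathcal{B})$ have the same Stieltjes transform on $\mathbb{C}\setminus\mathbb{R}$, they are equal. -/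
open MeasureTheory Filter Topology Complex

/-- The Stieltjes transform of a finite Borel measure on `ℝ`. -/
noncomputable def stieltjesTransform (μ : Measure ℝ) (z : ℂ) : ℂ :=
  ∫ x, ((x : ℂ) - z)⁻¹ ∂μ

/-- The imaginary part of the Stieltjes kernel is the (unnormalised) Poisson kernel. -/
lemma im_inv_ofReal_sub (x E η : ℝ) :
    (((x : ℂ) - (E + η * I))⁻¹).im = η / ((x - E) ^ 2 + η ^ 2) := by
  simp [Complex.inv_im, Complex.normSq_apply, sq]

lemma norm_inv_ofReal_sub_le (x : ℝ) {z : ℂ} (hz : z.im ≠ 0) :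
    ‖((x : ℂ) - z)⁻¹‖ ≤ |z.im|⁻¹ := by
  rw [norm_inv]
  refine inv_anti₀ (abs_pos.mpr hz) ?_
  simpa using Complex.abs_im_le_norm ((x : ℂ) - z)

lemma integrable_inv_ofReal_sub (μ : Measure ℝ) [IsFiniteMeasure μ] {z : ℂ} (hz : z.im ≠ 0) :
    Integrable (fun x : ℝ => ((x : ℂ) - z)⁻¹) μ :=
  .of_bound (by fun_prop) |z.im|⁻¹ (.of_forall fun x => norm_inv_ofReal_sub_le x hz)

lemma im_stieltjesTransform (μ : Measure ℝ) [IsFiniteMeasure μ] (E : ℝ) {η : ℝ} (hη : 0 < η) :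
    (stieltjesTransform μ (E + η * I)).im = ∫ x, η / ((x - E) ^ 2 + η ^ 2) ∂μ := by
  have hz : ((E : ℂ) + η * I).im ≠ 0 := by simpa using hη.ne'
  have h := integral_im (𝕜 := ℂ) (integrable_inv_ofReal_sub μ hz)
  simpa only [stieltjesTransform, RCLike.im_to_complex, im_inv_ofReal_sub] using h.symm

lemma intervalIntegral_poisson (α β x : ℝ) {η : ℝ} (hη : 0 < η) :
    ∫ E in α..β, η / ((x - E) ^ 2 + η ^ 2) =
      Real.arctan ((β - x) / η) - Real.arctan ((α - x) / η) := by
  have hpos : ∀ E : ℝ, (x - E) ^ 2 + η ^ 2 ≠ 0 := fun E => by positivity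
  refine intervalIntegral.integral_eq_sub_of_hasDerivAt
    (f := fun E => Real.arctan ((E - x) / η)) (fun E _ => ?_) ?_
  · refine (((hasDerivAt_id E).sub_const x).div_const η).arctan.congr_deriv ?_
    have hden : 1 + ((E - x) / η) ^ 2 = ((x - E) ^ 2 + η ^ 2) / η ^ 2 := by
      field_simp
      ring
    rw [id_eq, hden]
    field_simp
  · exact (continuous_const.div (by fun_prop) hpos).intervalIntegrable _ _

/-- Integrating the Poisson kernel over the energy first, by Fubini. -/
lemma intervalIntegral_im_stieltjesTransform (μ : Measure ℝ) [IsFiniteMeasure μ] (α β : ℝ)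
    {η : ℝ} (hη : 0 < η) :
    ∫ E in α..β, (stieltjesTransform μ (E + η * I)).im =
      ∫ x, (Real.arctan ((β - x) / η) - Real.arctan ((α - x) / η)) ∂μ := by
  simp only [im_stieltjesTransform μ _ hη, ← intervalIntegral_poisson α β _ hη]
  have : IsFiniteMeasure (volume.restrict (Set.uIoc α β)) :=
    inferInstanceAs (IsFiniteMeasure (volume.restrict (Set.Ioc _ _)))
  refine intervalIntegral_integral_swap (.of_bound ?_ η⁻¹ (.of_forall fun p => ?_))
  · refine Continuous.aestronglyMeasurable ?_
    exact continuous_const.div (by fun_prop) fun p => by positivity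
  · have h : 0 < (p.2 - p.1) ^ 2 + η ^ 2 := by positivity
    rw [Function.uncurry, Real.norm_of_nonneg (by positivity), inv_eq_one_div,
      div_le_div_iff₀ h hη]
    nlinarith [sq_nonneg (p.2 - p.1)]

lemma tendsto_arctan_div_nhdsGT_zero (c : ℝ) :
    Tendsto (fun η : ℝ => Real.arctan (c / η)) (𝓝[>] 0) (𝓝 (Real.pi / 2 * Real.sign c)) := by
  simp only [div_eq_mul_inv c]
  rcases lt_trichotomy c 0 with hc | rfl | hc
  · rw [Real.sign_of_neg hc, mul_neg_one]
    exact (tendsto_nhds_of_tendsto_nhdsWithin Real.tendsto_arctan_atBot).comp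
      (tendsto_inv_nhdsGT_zero.const_mul_atTop_of_neg hc)
  · simp
  · rw [Real.sign_of_pos hc, mul_one]
    exact (tendsto_nhds_of_tendsto_nhdsWithin Real.tendsto_arctan_atTop).comp
      (tendsto_inv_nhdsGT_zero.const_mul_atTop hc)

lemma half_sign_sub_sign_eq_indicator {α β : ℝ} (hαβ : α < β) (x : ℝ) :
    1 / 2 * (Real.sign (β - x) - Real.sign (α - x)) =
      (Set.Ioo α β).indicator 1 x +
        1 / 2 * (Set.indicator {α} 1 x + Set.indicator {β} 1 x) := by
  simp only [Set.indicator_apply, Set.mem_Ioo, Set.mem_singleton_iff, Pi.one_apply, Real.sign]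
  split_ifs <;> grind

lemma integral_half_sign_sub_sign (μ : Measure ℝ) [IsFiniteMeasure μ] {α β : ℝ} (hαβ : α < β) :
    ∫ x, 1 / 2 * (Real.sign (β - x) - Real.sign (α - x)) ∂μ =
      (μ (Set.Ioo α β)).toReal + 1 / 2 * ((μ {α}).toReal + (μ {β}).toReal) := by
  have hint : ∀ s : Set ℝ, MeasurableSet s → Integrable (s.indicator (1 : ℝ → ℝ)) μ :=
    fun s hs => (integrable_const 1).indicator hs
  have hα := hint {α} (measurableSet_singleton α)
  have hβ := hint {β} (measurableSet_singleton β)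
  simp only [half_sign_sub_sign_eq_indicator hαβ]
  have hαβ' : Integrable (fun x => Set.indicator {α} (1 : ℝ → ℝ) x + Set.indicator {β} 1 x) μ :=
    hα.add hβ
  rw [integral_add (hint _ measurableSet_Ioo) (hαβ'.const_mul _), integral_const_mul,
    integral_add hα hβ, integral_indicator_one measurableSet_Ioo,
    integral_indicator_one (measurableSet_singleton α),
    integral_indicator_one (measurableSet_singleton β)]
  rfl

lemma tendsto_integral_im_stieltjesTransform (μ : Measure ℝ) [IsFiniteMeasure μ] {α β : ℝ}
    (hαβ : α < β) :
    Tendsto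
      (fun η : ℝ => (1 / Real.pi) * ∫ E in α..β, (stieltjesTransform μ (E + η * I)).im)
      (𝓝[>] 0)
      (𝓝 ((μ (Set.Ioo α β)).toReal + (1 / 2) * ((μ {α}).toReal + (μ {β}).toReal))) := by
  have hlim : Tendsto
      (fun η : ℝ => ∫ x, (Real.arctan ((β - x) / η) - Real.arctan ((α - x) / η)) ∂μ) (𝓝[>] 0)
      (𝓝 (∫ x, (Real.pi / 2 * Real.sign (β - x) - Real.pi / 2 * Real.sign (α - x)) ∂μ)) := by
    refine tendsto_integral_filter_of_dominated_convergence (fun _ => Real.pi)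
      (.of_forall fun η => ?_) (.of_forall fun η => .of_forall fun x => ?_)
      (integrable_const _) (.of_forall fun x => ?_)
    · exact Measurable.aestronglyMeasurable (by fun_prop)
    · rw [Real.norm_eq_abs, abs_le]
      constructor <;>
        linarith [Real.arctan_lt_pi_div_two ((β - x) / η), Real.arctan_lt_pi_div_two ((α - x) / η),
          Real.neg_pi_div_two_lt_arctan ((β - x) / η), Real.neg_pi_div_two_lt_arctan ((α - x) / η)]
    · exact (tendsto_arctan_div_nhdsGT_zero _).sub (tendsto_arctan_div_nhdsGT_zero _)
  rw [← integral_half_sign_sub_sign μ hαβ]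
  convert! (hlim.const_mul (1 / Real.pi)).congr' ?_ using 2
  · rw [← integral_const_mul]
    congr 1 with x
    field_simp
  · filter_upwards [self_mem_nhdsWithin] with η hη
    rw [intervalIntegral_im_stieltjesTransform μ α β hη]

lemma tendsto_toReal_measure_Ioo_add_half_singleton (μ : Measure ℝ) [IsFiniteMeasure μ] (a : ℝ) :
    Tendsto (fun b => (μ (Set.Ioo a b)).toReal + 1 / 2 * ((μ {a}).toReal + (μ {b}).toReal))
      (𝓝[>] a) (𝓝 (1 / 2 * (μ {a}).toReal)) := by
  have hIoc : Tendsto (fun b => (μ (Set.Ioc a b)).toReal) (𝓝[>] a) (𝓝 0) := by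
    have h := tendsto_measure_biInter_gt (μ := μ) (s := fun b => Set.Ioc a b) (a := a)
      (fun _ _ => measurableSet_Ioc.nullMeasurableSet)
      (fun _ _ _ hij => Set.Ioc_subset_Ioc_right hij) ⟨a + 1, by simp, measure_ne_top _ _⟩
    have hempty : ⋂ r > a, Set.Ioc a r = ∅ := by
      refine Set.eq_empty_of_forall_notMem fun x hx => ?_
      simp only [Set.mem_iInter, Set.mem_Ioc] at hx
      have hax := (hx (a + 1) (by simp)).1
      obtain ⟨r, har, hrx⟩ := exists_between hax
      exact hrx.not_ge (hx r har).2
    rw [hempty, measure_empty] at h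
    exact (ENNReal.tendsto_toReal ENNReal.zero_ne_top).comp h
  have hle : ∀ b, Set.Ioo a b ⊆ Set.Ioc a b := fun _ => Set.Ioo_subset_Ioc_self
  have hIoo : Tendsto (fun b => (μ (Set.Ioo a b)).toReal) (𝓝[>] a) (𝓝 0) :=
    squeeze_zero (fun _ => ENNReal.toReal_nonneg) (fun b => measureReal_mono (hle b)) hIoc
  have hpt : Tendsto (fun b => (μ {b}).toReal) (𝓝[>] a) (𝓝 0) := by
    refine squeeze_zero' (.of_forall fun _ => ENNReal.toReal_nonneg) ?_ hIoc
    filter_upwards [self_mem_nhdsWithin] with b hb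
    exact measureReal_mono (Set.singleton_subset_iff.mpr (Set.right_mem_Ioc.mpr hb))
  simpa only [zero_add, add_zero] using hIoo.add ((hpt.const_add (μ {a}).toReal).const_mul (1 / 2))

lemma measure_ext_of_Ioo_add_half_singleton (μ ν : Measure ℝ) [IsFiniteMeasure μ]
    [IsFiniteMeasure ν]
    (h : ∀ a b, a < b →
      (μ (Set.Ioo a b)).toReal + 1 / 2 * ((μ {a}).toReal + (μ {b}).toReal) =
        (ν (Set.Ioo a b)).toReal + 1 / 2 * ((ν {a}).toReal + (ν {b}).toReal)) :
    μ = ν := by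
  have hatom : ∀ a, (μ {a}).toReal = (ν {a}).toReal := fun a => by
    have := tendsto_nhds_unique (tendsto_toReal_measure_Ioo_add_half_singleton μ a)
      ((tendsto_toReal_measure_Ioo_add_half_singleton ν a).congr' (by
        filter_upwards [self_mem_nhdsWithin] with b hb using (h a b hb).symm))
    linarith
  refine Measure.ext_of_Ioc μ ν fun a b hab => ?_
  have hIoo : μ (Set.Ioo a b) = ν (Set.Ioo a b) := by
    refine (ENNReal.toReal_eq_toReal_iff' (measure_ne_top _ _) (measure_ne_top _ _)).mp ?_
    linarith [h a b hab, hatom a, hatom b]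
  have hb : μ {b} = ν {b} :=
    (ENNReal.toReal_eq_toReal_iff' (measure_ne_top _ _) (measure_ne_top _ _)).mp (hatom b)
  have hdisj : Disjoint (Set.Ioo a b) {b} := by simp
  rw [← Set.Ioo_union_right hab, measure_union hdisj (measurableSet_singleton b),
    measure_union hdisj (measurableSet_singleton b), hIoo, hb]

/-- **Stieltjes inversion.** For a finite measure `μ` and `α < β`,
`(1/π) ∫_α^β Im S_μ(E + iη) dE → μ((α,β)) + (μ({α}) + μ({β}))/2` as `η ↘ 0`.
Consequently the Stieltjes transform is injective on finite measures. -/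
theorem stieltjes_inversion
    (μ : Measure ℝ) [IsFiniteMeasure μ] (α β : ℝ) (hαβ : α < β) :
    Tendsto
      (fun η : ℝ =>
        (1 / Real.pi) * ∫ E in α..β, (stieltjesTransform μ (E + η * Complex.I)).im)
      (nhdsWithin 0 (Set.Ioi 0))
      (𝓝 ((μ (Set.Ioo α β)).toReal +
        (1 / 2) * ((μ {α}).toReal + (μ {β}).toReal))) ∧
    (∀ μ' ν' : Measure ℝ, IsFiniteMeasure μ' → IsFiniteMeasure ν' →
      (∀ z : ℂ, z.im ≠ 0 → stieltjesTransform μ' z = stieltjesTransform ν' z) →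
      μ' = ν') := by
  refine ⟨tendsto_integral_im_stieltjesTransform μ hαβ, fun μ' ν' _ _ h => ?_⟩
  refine measure_ext_of_Ioo_add_half_singleton μ' ν' fun a b hab => ?_
  refine tendsto_nhds_unique (tendsto_integral_im_stieltjesTransform μ' hab) ?_
  refine (tendsto_integral_im_stieltjesTransform ν' hab).congr' ?_
  filter_upwards [self_mem_nhdsWithin] with η hη
  have him : ∀ E : ℝ, ((E : ℂ) + η * Complex.I).im ≠ 0 := fun E => by
    simpa using (Set.mem_Ioi.mp hη).ne'
  simp only [h _ (him _)]
end

section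
/- Let $Z \subseteq \mathbb{C}\setminus\mathbb{R}$ be a set having an accumulation point in $\mathbb{C}\setminus\mathbb{R}$, and let $(\mu_n)_n$ and $\mu$ be probability measures on $(\mathbb{R},\mathcal{B})$. Then $\mu_n \to \mu$ weakly if and only if $S_{\mu_n}(z) \to S_\mu(z)$ for every $z \in Z$. Moreover, if for every $z\in Z$ the limit $S(z) := \lim_n S_{\mu_n}(z)$ merely exists, then there is a sub-probability measure $\nu$ on $(\mathbb{R},\mathcal{B})$ with $\mu_n \to \nu$ vaguely and $S_\nu = S$ on $Z$. -/
open MeasureTheory Filter Topology Complex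

open scoped BoundedContinuousFunction

section SeparatingMeasures

variable {X : Type*} [MeasurableSpace X]

/-- Expansion of `∫ u / (1 - w u)` as a power series in `w`, with the moments of the bounded
function `u` as coefficients. -/
lemma hasSum_pow_mul_integral_pow_succ (P : Measure X) [IsFiniteMeasure P] {u : X → ℂ}
    (hu : AEStronglyMeasurable u P) {C : ℝ} (hC : ∀ x, ‖u x‖ ≤ C) {w : ℂ} (hw : ‖w‖ * C < 1) :
    HasSum (fun k : ℕ => w ^ k * ∫ x, u x ^ (k + 1) ∂P) (∫ x, u x / (1 - w * u x) ∂P) := by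
  rcases isEmpty_or_nonempty X with hX | ⟨⟨x₀⟩⟩
  · simp [Measure.eq_zero_of_isEmpty P, hasSum_zero]
  have hC0 : 0 ≤ C := (norm_nonneg _).trans (hC x₀)
  have hbound (k : ℕ) (x : X) : ‖w ^ k * u x ^ (k + 1)‖ ≤ (‖w‖ * C) ^ k * C := by
    rw [norm_mul, norm_pow, norm_pow, mul_pow, mul_assoc, ← pow_succ]
    gcongr
    exact hC x
  have hint (k : ℕ) : Integrable (fun x => w ^ k * u x ^ (k + 1)) P :=
    .of_bound ((hu.pow (k + 1)).const_mul (w ^ k)) _ (.of_forall (hbound k))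
  have hsum : Summable fun k : ℕ => ∫ x, ‖w ^ k * u x ^ (k + 1)‖ ∂P := by
    refine Summable.of_nonneg_of_le (fun k => by positivity) (fun k => ?_)
      (((summable_geometric_of_lt_one (by positivity) hw).mul_right C).mul_right (P.real Set.univ))
    calc ∫ x, ‖w ^ k * u x ^ (k + 1)‖ ∂P ≤ ∫ _, (‖w‖ * C) ^ k * C ∂P :=
          integral_mono (hint k).norm (integrable_const _) (hbound k)
      _ = (‖w‖ * C) ^ k * C * P.real Set.univ := by simp [mul_comm]
  have hval : ∫ x, ∑' k : ℕ, w ^ k * u x ^ (k + 1) ∂P = ∫ x, u x / (1 - w * u x) ∂P := by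
    refine integral_congr_ae (.of_forall fun x => ?_)
    have hlt : ‖w * u x‖ < 1 := by
      rw [norm_mul]
      exact (mul_le_mul_of_nonneg_left (hC x) (norm_nonneg w)).trans_lt hw
    have := (hasSum_geometric_of_norm_lt_one hlt).mul_left (u x)
    simp only [div_eq_mul_inv]
    rw [← this.tsum_eq]
    exact tsum_congr fun k => by ring
  have key := hasSum_integral_of_summable_integral_norm hint hsum
  rw [hval] at key
  simpa only [integral_const_mul] using key

/-- If `∫ u / (1 - w u)` agrees for two measures at points `w` accumulating at `0`, then all
moments of the bounded function `u` agree. -/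
lemma integral_pow_succ_eq_of_frequently {P Q : Measure X} [IsFiniteMeasure P]
    [IsFiniteMeasure Q] {u : X → ℂ} (huP : AEStronglyMeasurable u P)
    (huQ : AEStronglyMeasurable u Q) {C : ℝ} (hC : ∀ x, ‖u x‖ ≤ C)
    (h : ∃ᶠ w in 𝓝[≠] (0 : ℂ), ∫ x, u x / (1 - w * u x) ∂P = ∫ x, u x / (1 - w * u x) ∂Q)
    (k : ℕ) : ∫ x, u x ^ (k + 1) ∂P = ∫ x, u x ^ (k + 1) ∂Q := by
  set d : ℕ → ℂ := fun k => ∫ x, u x ^ (k + 1) ∂P - ∫ x, u x ^ (k + 1) ∂Q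
  set F : ℂ → ℂ := fun w => ∫ x, u x / (1 - w * u x) ∂P - ∫ x, u x / (1 - w * u x) ∂Q
  have hev : ∀ᶠ w : ℂ in 𝓝 0, ‖w‖ * C < 1 := by
    have : Tendsto (fun w : ℂ => ‖w‖ * C) (𝓝 0) (𝓝 0) := by
      simpa using (continuous_norm.tendsto (0 : ℂ)).mul_const C
    exact this.eventually (gt_mem_nhds one_pos)
  have hF : HasFPowerSeriesAt F (FormalMultilinearSeries.ofScalars ℂ d) 0 := by
    rw [hasFPowerSeriesAt_iff]
    filter_upwards [hev] with w hw
    simpa [F, d, FormalMultilinearSeries.coeff_ofScalars, mul_sub] using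
      (hasSum_pow_mul_integral_pow_succ P huP hC hw).sub
        (hasSum_pow_mul_integral_pow_succ Q huQ hC hw)
  have hF0 : ∀ᶠ w in 𝓝 0, F w = 0 :=
    hF.analyticAt.frequently_zero_iff_eventually_zero.1 (h.mono fun w hw => sub_eq_zero.2 hw)
  have hd : FormalMultilinearSeries.ofScalars ℂ d = 0 :=
    (hF.congr hF0).eq_zero
  have hdk : d k = 0 := by
    rw [← FormalMultilinearSeries.coeff_ofScalars (𝕜 := ℂ) (p := d), hd]
    rfl
  exact sub_eq_zero.1 hdk

variable [TopologicalSpace X] [BorelSpace X]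

/-- A bounded continuous injective function `u` with `u ū = c (u - ū)` (so that its values lie on
a circle through the origin) determines a finite measure through its moments. -/
lemma measure_ext_of_integral_pow_eq [PolishSpace X] {P Q : Measure X} [IsFiniteMeasure P]
    [IsFiniteMeasure Q] {u : X →ᵇ ℂ} (hinj : Function.Injective u) {c : ℂ}
    (hc : u * star u = c • (u - star u))
    (h : ∀ k : ℕ, ∫ x, u x ^ k ∂P = ∫ x, u x ^ k ∂Q) : P = Q := by
  have hadd {f g : X →ᵇ ℂ} (κ : Measure X) [IsFiniteMeasure κ] :
      ∫ x, (f + g) x ∂κ = ∫ x, f x ∂κ + ∫ x, g x ∂κ :=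
    integral_add (f.integrable κ) (g.integrable κ)
  have hsmul (a : ℂ) (f : X →ᵇ ℂ) (κ : Measure X) :
      ∫ x, (a • f) x ∂κ = a * ∫ x, f x ∂κ :=
    integral_const_mul a _
  let W : Submodule ℂ (X →ᵇ ℂ) :=
    { carrier := {f | ∫ x, f x ∂P = ∫ x, f x ∂Q}
      zero_mem' := by simp
      add_mem' := fun {f g} hf hg => by
        simp only [Set.mem_ofPred_eq] at hf hg ⊢
        rw [hadd, hadd, hf, hg]
      smul_mem' := fun a f hf => by
        simp only [Set.mem_ofPred_eq] at hf ⊢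
        rw [hsmul, hsmul, hf] }
  have hpow (k : ℕ) : u ^ k ∈ W := h k
  have hstar (k : ℕ) : star u ^ k ∈ W := by
    change ∫ x, (star (u x)) ^ k ∂P = ∫ x, (star (u x)) ^ k ∂Q
    simp_rw [← star_pow]
    have := congrArg (starRingEnd ℂ) (h k)
    rwa [← integral_conj, ← integral_conj] at this
  have hmono (N : ℕ) : ∀ j k : ℕ, j + k = N → u ^ j * star u ^ k ∈ W := by
    induction N with
    | zero =>
      intro j k hjk
      obtain ⟨rfl, rfl⟩ : j = 0 ∧ k = 0 := by omega
      simpa using hpow 0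
    | succ N ih =>
      rintro (_ | j) (_ | k) hjk
      · simpa using hpow 0
      · simpa using hstar (k + 1)
      · simpa using hpow (j + 1)
      · have : u ^ (j + 1) * star u ^ (k + 1)
            = c • (u ^ (j + 1) * star u ^ k - u ^ j * star u ^ (k + 1)) := by
          calc u ^ (j + 1) * star u ^ (k + 1) = (u * star u) * (u ^ j * star u ^ k) := by ring
            _ = c • ((u - star u) * (u ^ j * star u ^ k)) := by rw [hc, smul_mul_assoc]
            _ = _ := by congr 1; ring
        rw [this]
        exact W.smul_mem _ (W.sub_mem (ih _ _ (by omega)) (ih _ _ (by omega)))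
  refine ext_of_forall_mem_subalgebra_integral_eq_of_polish (𝕜 := ℂ)
    (A := StarAlgebra.adjoin ℂ {u}) ?_ fun g hg => ?_
  · intro x y hxy
    refine ⟨u, ⟨u.toContinuousMap, ⟨u, ?_, rfl⟩, rfl⟩, hinj.ne hxy⟩
    exact StarAlgebra.subset_adjoin ℂ {u} rfl
  · rw [← StarSubalgebra.mem_toSubalgebra, StarAlgebra.adjoin_toSubalgebra,
      ← Subalgebra.mem_toSubmodule, Algebra.adjoin_eq_span] at hg
    refine (Submodule.span_le (p := W)).2 ?_ hg
    intro f hf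
    rw [Set.star_singleton, Set.singleton_union, SetLike.mem_coe, Submonoid.mem_closure_pair] at hf
    obtain ⟨j, k, rfl⟩ := hf
    exact hmono _ j k rfl

/-- Weak convergence can be tested after pushing forward along an open embedding. -/
lemma tendsto_of_tendsto_map_isOpenEmbedding {Y ι : Type*} [MeasurableSpace Y]
    [TopologicalSpace Y] [BorelSpace Y] [HasOuterApproxClosed Y] {e : X → Y}
    (he : IsOpenEmbedding e) {l : Filter ι} [l.IsCountablyGenerated]
    {μ : ι → ProbabilityMeasure X} {ν : ProbabilityMeasure X}
    (h : Tendsto (fun i => (μ i).map he.continuous.aemeasurable) l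
      (𝓝 (ν.map he.continuous.aemeasurable))) : Tendsto μ l (𝓝 ν) := by
  refine tendsto_of_forall_isOpen_le_liminf' fun G hG => ?_
  have key := ProbabilityMeasure.le_liminf_measure_open_of_tendsto h (he.isOpenMap G hG)
  simpa [ProbabilityMeasure.toMeasure_map, he.measurableEmbedding.map_apply,
    Set.preimage_image_eq _ he.injective] using key

end SeparatingMeasures

namespace OnePoint

instance : MeasurableSpace (OnePoint ℝ) := borel _

instance : BorelSpace (OnePoint ℝ) := ⟨rfl⟩

lemma measurableEmbedding_coe_real : MeasurableEmbedding ((↑) : ℝ → OnePoint ℝ) :=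
  isOpenEmbedding_coe.measurableEmbedding

/-- The extension by `0` at infinity of a continuous function vanishing at infinity. -/
noncomputable def extendZero {E : Type*} [NormedAddCommGroup E] (f : ℝ → E) (hf : Continuous f)
    (hf0 : Tendsto f (cocompact ℝ) (𝓝 0)) : OnePoint ℝ →ᵇ E :=
  BoundedContinuousFunction.mkOfCompact
    (continuousMapMk ⟨f, hf⟩ 0 (by simpa [coclosedCompact_eq_cocompact] using hf0))

variable {E : Type*} [NormedAddCommGroup E] {f : ℝ → E} (hf : Continuous f)
  (hf0 : Tendsto f (cocompact ℝ) (𝓝 0))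

@[simp]
lemma extendZero_coe (x : ℝ) : extendZero f hf hf0 x = f x := rfl

@[simp]
lemma extendZero_infty : extendZero f hf hf0 ∞ = 0 := rfl

lemma integral_extendZero [NormedSpace ℝ E] (P : Measure (OnePoint ℝ)) :
    ∫ p, extendZero f hf hf0 p ∂P = ∫ x, f x ∂(P.comap (↑)) := by
  have := measurableEmbedding_coe_real.integral_map (μ := P.comap (↑)) (extendZero f hf hf0)
  rw [measurableEmbedding_coe_real.map_comap,
    setIntegral_eq_integral_of_forall_compl_eq_zero] at this
  · exact this
  · intro p hp
    rw [notMem_range_coe_iff.1 hp, extendZero_infty]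

lemma integral_map_extendZero [NormedSpace ℝ E] (μ : Measure ℝ) :
    ∫ p, extendZero f hf hf0 p ∂(μ.map (↑)) = ∫ x, f x ∂μ := by
  rw [integral_extendZero, measurableEmbedding_coe_real.comap_map]

end OnePoint

section Resolvent

open OnePoint

variable {z : ℂ}

lemma ofReal_sub_ne_zero (hz : z.im ≠ 0) (x : ℝ) : (x : ℂ) - z ≠ 0 := fun h =>
  hz (by simpa using congrArg Complex.im h)

lemma continuous_inv_ofReal_sub (hz : z.im ≠ 0) : Continuous fun x : ℝ => ((x : ℂ) - z)⁻¹ :=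
  (by fun_prop : Continuous fun x : ℝ => (x : ℂ) - z).inv₀ (ofReal_sub_ne_zero hz)

lemma tendsto_inv_ofReal_sub_cocompact (z : ℂ) :
    Tendsto (fun x : ℝ => ((x : ℂ) - z)⁻¹) (cocompact ℝ) (𝓝 0) := by
  have h : Tendsto (fun x : ℝ => (x : ℂ)) (cocompact ℝ) (cocompact ℂ) :=
    Complex.isometry_ofReal.isClosedEmbedding.tendsto_cocompact
  have h' : Tendsto (fun w : ℂ => w - z) (cocompact ℂ) (cocompact ℂ) :=
    (Homeomorph.subRight z).isClosedEmbedding.tendsto_cocompact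
  rw [← Metric.cobounded_eq_cocompact (α := ℂ)] at h h'
  exact (Filter.tendsto_inv₀_cobounded (α := ℂ)).comp (h'.comp h)

/-- The function `x ↦ (x - z)⁻¹`, extended by `0` at infinity. -/
noncomputable def resolventFunction (z : ℂ) (hz : z.im ≠ 0) : OnePoint ℝ →ᵇ ℂ :=
  extendZero _ (continuous_inv_ofReal_sub hz) (tendsto_inv_ofReal_sub_cocompact z)

lemma resolventFunction_injective (hz : z.im ≠ 0) :
    Function.Injective (resolventFunction z hz) := by
  intro p q h
  induction p using OnePoint.rec <;> induction q using OnePoint.rec <;>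
    simp_all [resolventFunction, ofReal_sub_ne_zero, eq_comm]

lemma resolventFunction_mul_star (hz : z.im ≠ 0) :
    resolventFunction z hz * star (resolventFunction z hz) =
      (2 * z.im * I)⁻¹ • (resolventFunction z hz - star (resolventFunction z hz)) := by
  ext p
  induction p using OnePoint.rec with
  | infty => simp [resolventFunction]
  | coe x =>
    have h1 := ofReal_sub_ne_zero hz x
    have h2 : (x : ℂ) - (starRingEnd ℂ) z ≠ 0 := ofReal_sub_ne_zero (by simpa using hz) x
    have h3 : (z.im : ℂ) ≠ 0 := by exact_mod_cast hz
    simp [resolventFunction]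
    field_simp
    have h4 := Complex.sub_conj z
    push_cast at h4
    linear_combination I * h4 + 2 * z.im * I_sq

instance : PolishSpace (OnePoint ℝ) :=
  have hI : I.im ≠ 0 := by simp
  ((resolventFunction I hI).continuous.isClosedEmbedding
    (resolventFunction_injective hI)).polishSpace

/-- Resolvents at nearby points are fractional linear functions of each other. -/
lemma resolventFunction_div {z₀ w : ℂ} (hz₀ : z₀.im ≠ 0) (hw : (z₀ + w).im ≠ 0)
    (p : OnePoint ℝ) :
    resolventFunction z₀ hz₀ p / (1 - w * resolventFunction z₀ hz₀ p) =
      resolventFunction (z₀ + w) hw p := by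
  induction p using OnePoint.rec with
  | infty => simp [resolventFunction]
  | coe x =>
    have h1 := ofReal_sub_ne_zero hz₀ x
    have h2 := ofReal_sub_ne_zero hw x
    have h3 : (x : ℂ) - z₀ - w ≠ 0 := by rwa [sub_sub]
    simp only [resolventFunction, extendZero_coe]
    rw [← sub_sub]
    field_simp

/-- Probability measures on the one-point compactification of `ℝ` are determined by the integrals
of the resolvents at a set of points accumulating off the real line. -/
lemma probabilityMeasure_eq_of_integral_resolventFunction_eq {Z : Set ℂ}
    (hacc : ∃ z₀ : ℂ, z₀.im ≠ 0 ∧ AccPt z₀ (𝓟 Z)) {P Q : ProbabilityMeasure (OnePoint ℝ)}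
    (h : ∀ z ∈ Z, ∀ hz : z.im ≠ 0,
      ∫ p, resolventFunction z hz p ∂(P : Measure (OnePoint ℝ)) =
        ∫ p, resolventFunction z hz p ∂(Q : Measure (OnePoint ℝ))) : P = Q := by
  obtain ⟨z₀, hz₀, hZ⟩ := hacc
  have hfreq : ∃ᶠ w in 𝓝[≠] (0 : ℂ), z₀ + w ∈ Z := by
    rw [accPt_iff_frequently_nhdsNE] at hZ
    have hmap : map (fun w => z₀ + w) (𝓝[≠] (0 : ℂ)) = 𝓝[≠] z₀ := by
      simp
    rwa [← hmap, frequently_map] at hZ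
  have him : ∀ᶠ w in 𝓝[≠] (0 : ℂ), (z₀ + w).im ≠ 0 := by
    refine nhdsWithin_le_nhds ?_
    have : ContinuousAt (fun w : ℂ => (z₀ + w).im) 0 := by fun_prop
    exact this.eventually_ne (by simpa using hz₀)
  have hu (R : Measure (OnePoint ℝ)) : AEStronglyMeasurable (resolventFunction z₀ hz₀) R :=
    (resolventFunction z₀ hz₀).continuous.aestronglyMeasurable
  refine ProbabilityMeasure.toMeasure_injective (measure_ext_of_integral_pow_eq
    (resolventFunction_injective hz₀) (resolventFunction_mul_star hz₀) fun k => ?_)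
  cases k with
  | zero => simp
  | succ k =>
    refine integral_pow_succ_eq_of_frequently (hu _) (hu _)
      (resolventFunction z₀ hz₀).norm_coe_le_norm ((hfreq.and_eventually him).mono ?_) k
    rintro w ⟨hwZ, hw⟩
    simp_rw [resolventFunction_div hz₀ hw]
    exact h _ hwZ hw

/-- Convergence of the integrals of the resolvents at a set of points accumulating off the real
line implies weak convergence on the one-point compactification of `ℝ`. -/
lemma tendsto_of_tendsto_integral_resolventFunction {ι : Type*} {l : Filter ι} {Z : Set ℂ}
    (hacc : ∃ z₀ : ℂ, z₀.im ≠ 0 ∧ AccPt z₀ (𝓟 Z))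
    {P : ι → ProbabilityMeasure (OnePoint ℝ)} {Q : ProbabilityMeasure (OnePoint ℝ)}
    (h : ∀ z ∈ Z, ∀ hz : z.im ≠ 0,
      Tendsto (fun i => ∫ p, resolventFunction z hz p ∂(P i : Measure (OnePoint ℝ))) l
        (𝓝 (∫ p, resolventFunction z hz p ∂(Q : Measure (OnePoint ℝ))))) :
    Tendsto P l (𝓝 Q) := by
  refine tendsto_nhds_of_unique_mapClusterPt fun R hR => ?_
  obtain ⟨U, hU, hUR⟩ := mapClusterPt_iff_ultrafilter.1 hR
  refine probabilityMeasure_eq_of_integral_resolventFunction_eq hacc fun z hzZ hz => ?_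
  exact tendsto_nhds_unique
    ((ProbabilityMeasure.tendsto_iff_forall_integral_rclike_tendsto ℂ).1 hUR _)
    ((h z hzZ hz).mono_left hU)

end Resolvent

/-- **Stieltjes transform convergence theorem.** Let `Z ⊆ ℂ \ ℝ` have an accumulation
point in `ℂ \ ℝ`.  Probability measures `μ n` converge weakly to a probability measure
`ν` iff their Stieltjes transforms converge pointwise on `Z`; and if the Stieltjes
transforms merely converge pointwise on `Z`, there is a sub-probability measure to which
the `μ n` converge vaguely and whose Stieltjes transform is the limit on `Z`. -/
theorem stieltjes_convergence_theorem
    (Z : Set ℂ) (hZ : Z ⊆ {z : ℂ | z.im ≠ 0})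
    (hacc : ∃ z₀ : ℂ, z₀.im ≠ 0 ∧ AccPt z₀ (Filter.principal Z))
    (μ : ℕ → Measure ℝ) [∀ n, IsProbabilityMeasure (μ n)]
    (ν : Measure ℝ) [IsProbabilityMeasure ν] :
    ((∀ f : ℝ → ℝ, Continuous f → (∃ C, ∀ x, |f x| ≤ C) →
        Tendsto (fun n => ∫ x, f x ∂(μ n)) atTop (𝓝 (∫ x, f x ∂ν))) ↔
      (∀ z ∈ Z, Tendsto (fun n => stieltjesTransform (μ n) z) atTop
        (𝓝 (stieltjesTransform ν z)))) ∧
    ((∀ z ∈ Z, ∃ L : ℂ, Tendsto (fun n => stieltjesTransform (μ n) z) atTop (𝓝 L)) →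
      ∃ ρ : Measure ℝ, ρ Set.univ ≤ 1 ∧
        (∀ f : ℝ → ℝ, Continuous f → HasCompactSupport f →
          Tendsto (fun n => ∫ x, f x ∂(μ n)) atTop (𝓝 (∫ x, f x ∂ρ))) ∧
        (∀ z ∈ Z, Tendsto (fun n => stieltjesTransform (μ n) z) atTop
          (𝓝 (stieltjesTransform ρ z)))) := by
  have hcont : Continuous ((↑) : ℝ → OnePoint ℝ) := OnePoint.continuous_coe
  let m : ℕ → ProbabilityMeasure ℝ := fun n => ⟨μ n, inferInstance⟩
  let P : ℕ → ProbabilityMeasure (OnePoint ℝ) := fun n => (m n).map hcont.aemeasurable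
  have hP (n : ℕ) (z : ℂ) (hz : z.im ≠ 0) :
      ∫ p, resolventFunction z hz p ∂(P n : Measure (OnePoint ℝ)) =
        stieltjesTransform (μ n) z :=
    OnePoint.integral_map_extendZero _ _ (μ n)
  refine ⟨⟨fun h z hz => ?_, fun h f hf hbdd => ?_⟩, fun h => ?_⟩
  · have hm : Tendsto m atTop (𝓝 (⟨ν, inferInstance⟩ : ProbabilityMeasure ℝ)) :=
      ProbabilityMeasure.tendsto_iff_forall_integral_tendsto.2 fun f =>
        h f f.continuous ⟨‖f‖, f.norm_coe_le_norm⟩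
    exact (ProbabilityMeasure.tendsto_iff_forall_integral_rclike_tendsto ℂ).1 hm
      ((resolventFunction z (hZ hz)).compContinuous ⟨_, hcont⟩)
  · obtain ⟨C, hC⟩ := hbdd
    let n : ProbabilityMeasure ℝ := ⟨ν, inferInstance⟩
    have hPn : Tendsto P atTop (𝓝 (n.map hcont.aemeasurable)) := by
      refine tendsto_of_tendsto_integral_resolventFunction hacc fun z hzZ hz => ?_
      simp_rw [hP]
      convert h z hzZ using 2
      exact OnePoint.integral_map_extendZero _ _ ν
    have hm : Tendsto m atTop (𝓝 n) :=
      tendsto_of_tendsto_map_isOpenEmbedding OnePoint.isOpenEmbedding_coe hPn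
    exact ProbabilityMeasure.tendsto_iff_forall_integral_tendsto.1 hm
      (BoundedContinuousFunction.ofNormedAddCommGroup f hf C hC)
  · obtain ⟨Q, hQ⟩ := exists_clusterPt_of_compactSpace (map P atTop)
    obtain ⟨U, hU, hUQ⟩ := mapClusterPt_iff_ultrafilter.1 hQ
    have hPQ : Tendsto P atTop (𝓝 Q) := by
      refine tendsto_of_tendsto_integral_resolventFunction hacc fun z hzZ hz => ?_
      obtain ⟨L, hL⟩ := h z hzZ
      simp_rw [← hP _ z hz] at hL
      have := (ProbabilityMeasure.tendsto_iff_forall_integral_rclike_tendsto ℂ).1 hUQ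
        (resolventFunction z hz)
      rwa [← tendsto_nhds_unique (hL.mono_left hU) this]
    refine ⟨(Q : Measure (OnePoint ℝ)).comap (↑), ?_, fun f hf hsupp => ?_, fun z hzZ => ?_⟩
    · rw [OnePoint.measurableEmbedding_coe_real.comap_apply]
      exact prob_le_one
    · have hf0 : Tendsto f (cocompact ℝ) (𝓝 0) := hsupp.is_zero_at_infty
      have := ProbabilityMeasure.tendsto_iff_forall_integral_tendsto.1 hPQ
        (OnePoint.extendZero f hf hf0)
      rw [OnePoint.integral_extendZero] at this
      refine this.congr fun n => ?_
      exact OnePoint.integral_map_extendZero hf hf0 (μ n)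
    · have := (ProbabilityMeasure.tendsto_iff_forall_integral_rclike_tendsto ℂ).1 hPQ
        (resolventFunction z (hZ hzZ))
      simp_rw [hP] at this
      convert this using 2
      exact (OnePoint.integral_extendZero _ _ _).symm
end
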